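/- Convergence of the asynchronous Sinkhorn algorithm: with the initialization v⁰(y) = 1 for all y ∈ Y, the iterates v^ℓ converge pointwise to a limit v^∞ satisfying v^∞(y) ≥ exp(−C/ε) > 0 for all y ∈ Y; the iterates u^ℓ converge pointwise to u^∞ defined by u^∞(x) := μ(x)/Σ_{y} K(x,y)v^∞(y); the limit pair satisfies both scaling equations u^∞(x)·Σ_{y} K(x,y)·v^∞(y) = μ(x) for all x and v^∞(y)·Σ_{x} K(x,y)·u^∞(x) = ν(y) for all y; and q^ℓ → 1 as ℓ → ∞. -/

import Mathlib

/-- One `u`-update of the Sinkhorn algorithm: `u(x) = μ(x) / Σ_y K(x,y) v(y)`. -/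
noncomputable def uOf {X Y : Type*} [Fintype Y] (K : X → Y → ℝ) (μ : X → ℝ)
    (v : Y → ℝ) : X → ℝ :=
  fun x => μ x / ∑ y, K x y * v y

/-- One `v̂`-update of the Sinkhorn algorithm: `v̂(y) = ν(y) / Σ_x K(x,y) u(x)`. -/
noncomputable def vhatOf {X Y : Type*} [Fintype X] (K : X → Y → ℝ) (ν : Y → ℝ)
    (u : X → ℝ) : Y → ℝ :=
  fun y => ν y / ∑ x, K x y * u x

/-- The `v`-iterates of the asynchronous Sinkhorn algorithm:
`v⁰ = v0`, `v^{ℓ+1}(y) = min (v^ℓ(y), v̂^{ℓ+1}(y))` with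
`v̂^{ℓ+1} = vhatOf K ν (uOf K μ (v^ℓ))`. -/
noncomputable def sinkV {X Y : Type*} [Fintype X] [Fintype Y] (K : X → Y → ℝ)
    (μ : X → ℝ) (ν : Y → ℝ) (v0 : Y → ℝ) : ℕ → Y → ℝ
  | 0 => v0
  | ℓ + 1 => fun y =>
      min (sinkV K μ ν v0 ℓ y) (vhatOf K ν (uOf K μ (sinkV K μ ν v0 ℓ)) y)

open Filter Topology

section Sinkhorn

variable {X Y : Type*} {K : X → Y → ℝ} {μ : X → ℝ} {ν : Y → ℝ}

lemma uOf_denom_pos [Fintype Y] [Nonempty Y] (hK : ∀ x y, 0 < K x y) {v : Y → ℝ} (hv : ∀ y, 0 < v y)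
    (x : X) : 0 < ∑ y, K x y * v y :=
  Finset.sum_pos (fun y _ => mul_pos (hK x y) (hv y)) Finset.univ_nonempty

lemma uOf_pos [Fintype Y] [Nonempty Y] (hK : ∀ x y, 0 < K x y) (hμ : ∀ x, 0 < μ x) {v : Y → ℝ}
    (hv : ∀ y, 0 < v y) (x : X) : 0 < uOf K μ v x :=
  div_pos (hμ x) (uOf_denom_pos hK hv x)

lemma vhatOf_denom_pos [Fintype X] [Nonempty X]
    (hK : ∀ x y, 0 < K x y) {u : X → ℝ} (hu : ∀ x, 0 < u x)
    (y : Y) : 0 < ∑ x, K x y * u x :=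
  Finset.sum_pos (fun x _ => mul_pos (hK x y) (hu x)) Finset.univ_nonempty

lemma uOf_mul_denom [Fintype Y] [Nonempty Y] (hK : ∀ x y, 0 < K x y) {v : Y → ℝ} (hv : ∀ y, 0 < v y)
    (x : X) : uOf K μ v x * ∑ y, K x y * v y = μ x :=
  div_mul_cancel₀ _ (uOf_denom_pos hK hv x).ne'

/-- After a `u`-update the `Y`-marginal has the same total mass as `μ`. -/
lemma sum_marginal_eq [Fintype X] [Fintype Y] [Nonempty Y]
    (hK : ∀ x y, 0 < K x y) {v : Y → ℝ} (hv : ∀ y, 0 < v y) :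
    ∑ y, v y * ∑ x, K x y * uOf K μ v x = ∑ x, μ x := by
  simp_rw [← uOf_mul_denom (μ := μ) hK hv, Finset.mul_sum]
  rw [Finset.sum_comm]
  exact Finset.sum_congr rfl fun x _ => Finset.sum_congr rfl fun y _ => by ring

lemma uOf_antitone [Fintype Y] [Nonempty Y]
    (hK : ∀ x y, 0 < K x y) (hμ : ∀ x, 0 < μ x) {v w : Y → ℝ}
    (hv : ∀ y, 0 < v y) (hvw : ∀ y, v y ≤ w y) (x : X) : uOf K μ w x ≤ uOf K μ v x :=
  div_le_div_of_nonneg_left (hμ x).le (uOf_denom_pos hK hv x)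
    (Finset.sum_le_sum fun y _ => mul_le_mul_of_nonneg_left (hvw y) (hK x y).le)

lemma vhatOf_denom_antitone [Fintype X] [Fintype Y] [Nonempty Y]
    (hK : ∀ x y, 0 < K x y) (hμ : ∀ x, 0 < μ x)
    {v w : Y → ℝ} (hv : ∀ y, 0 < v y) (hvw : ∀ y, v y ≤ w y) (y : Y) :
    ∑ x, K x y * uOf K μ w x ≤ ∑ x, K x y * uOf K μ v x :=
  Finset.sum_le_sum fun x _ => mul_le_mul_of_nonneg_left (uOf_antitone hK hμ hv hvw x) (hK x y).le

/-- If no coordinate would decrease in a `v`-update, then the second scaling equation holds. -/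
lemma mul_vhatOf_denom_eq_of_le [Fintype X] [Fintype Y] [Nonempty X] [Nonempty Y]
    (hK : ∀ x y, 0 < K x y)
    (hμ : ∀ x, 0 < μ x) (hmass : ∑ x, μ x = ∑ y, ν y) {v : Y → ℝ} (hv : ∀ y, 0 < v y)
    (hle : ∀ y, v y ≤ vhatOf K ν (uOf K μ v) y) (y : Y) :
    v y * ∑ x, K x y * uOf K μ v x = ν y := by
  have h : ∀ y ∈ Finset.univ, v y * ∑ x, K x y * uOf K μ v x ≤ ν y := fun y _ =>
    (le_div_iff₀ (vhatOf_denom_pos hK (uOf_pos hK hμ hv) y)).1 (hle y)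
  exact (Finset.sum_eq_sum_iff_of_le h).1 ((sum_marginal_eq hK hv).trans hmass) y
    (Finset.mem_univ y)

/-- Two `v̂`-values differ at most by the oscillation factor of the normalized kernel. -/
lemma mul_vhatOf_le_vhatOf [Fintype X] [Nonempty X] (hK : ∀ x y, 0 < K x y) {a : ℝ}
    (ha : ∀ x y z, a * K x y * ν z ≤ K x z * ν y) {u : X → ℝ} (hu : ∀ x, 0 < u x) (y z : Y) :
    a * vhatOf K ν u z ≤ vhatOf K ν u y := by
  unfold vhatOf
  rw [← mul_div_assoc, div_le_div_iff₀ (vhatOf_denom_pos hK hu z) (vhatOf_denom_pos hK hu y),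
    Finset.mul_sum, Finset.mul_sum]
  refine Finset.sum_le_sum fun x _ => ?_
  have := mul_le_mul_of_nonneg_right (ha x y z) (hu x).le
  linarith

lemma sinkV_succ_le [Fintype X] [Fintype Y] (v₀ : Y → ℝ) (n : ℕ) (y : Y) :
    sinkV K μ ν v₀ (n + 1) y ≤ sinkV K μ ν v₀ n y :=
  min_le_left _ _

/-- Invariants of the iteration started at `1`: the iterates stay above `a`, some coordinate
still equals `1`, and every decreased coordinate has too much mass. -/
lemma sinkV_invariant [Fintype X] [Fintype Y] [Nonempty X] [Nonempty Y]
    (hK : ∀ x y, 0 < K x y) (hμ : ∀ x, 0 < μ x)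
    (hmass : ∑ x, μ x = ∑ y, ν y) {a : ℝ} (ha₀ : 0 < a) (ha₁ : a ≤ 1)
    (ha : ∀ x y z, a * K x y * ν z ≤ K x z * ν y) {v₀ : Y → ℝ} (hv₀ : ∀ y, v₀ y = 1) (n : ℕ) :
    (∀ y, a ≤ sinkV K μ ν v₀ n y) ∧ (∃ y, sinkV K μ ν v₀ n y = 1) ∧
      ∀ y, sinkV K μ ν v₀ n y = 1 ∨
        ν y ≤ sinkV K μ ν v₀ n y * ∑ x, K x y * uOf K μ (sinkV K μ ν v₀ n) x := by
  induction n with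
  | zero =>
    exact ⟨fun y => ha₁.trans_eq (hv₀ y).symm, ⟨Classical.arbitrary Y, hv₀ _⟩,
      fun y => Or.inl (hv₀ y)⟩
  | succ n ih =>
    obtain ⟨hlow, ⟨y₀, hy₀⟩, hor⟩ := ih
    have hstep : ∀ y, sinkV K μ ν v₀ (n + 1) y = min (sinkV K μ ν v₀ n y)
      (vhatOf K ν (uOf K μ (sinkV K μ ν v₀ n)) y) := fun y => rfl
    have hmono := sinkV_succ_le (K := K) (μ := μ) (ν := ν) v₀ n
    generalize sinkV K μ ν v₀ n = v at *
    generalize sinkV K μ ν v₀ (n + 1) = w at *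
    have hv : ∀ y, 0 < v y := fun y => ha₀.trans_le (hlow y)
    have hu := uOf_pos hK hμ hv
    have hS := vhatOf_denom_pos hK hu
    have hT : ∀ y, vhatOf K ν (uOf K μ v) y = ν y / ∑ x, K x y * uOf K μ v x := fun y => rfl
    have hone : ∃ y, w y = 1 := by
      by_contra! hne
      have hlt : ∀ y, v y = 1 → ν y < v y * ∑ x, K x y * uOf K μ v x := fun y hy => by
        by_contra! hle
        exact hne y (by rw [hstep, hT, min_eq_left ((le_div_iff₀ (hS y)).2 hle), hy])
      have : ∑ y, ν y < ∑ y, v y * ∑ x, K x y * uOf K μ v x :=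
        Finset.sum_lt_sum (fun y _ => (hor y).elim (fun h => (hlt y h).le) id)
          ⟨y₀, Finset.mem_univ _, hlt y₀ hy₀⟩
      rw [sum_marginal_eq hK hv, hmass] at this
      exact this.false
    have hwlow : ∀ y, a ≤ w y := fun y => by
      obtain ⟨z, hz⟩ := hone
      have hz1 : 1 ≤ vhatOf K ν (uOf K μ v) z := by
        rw [← hz, hstep]; exact min_le_right _ _
      rw [hstep]
      exact le_min (hlow y) ((le_mul_of_one_le_right ha₀.le hz1).trans
        (mul_vhatOf_le_vhatOf hK ha hu y z))
    have hw : ∀ y, 0 < w y := fun y => ha₀.trans_le (hwlow y)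
    have hanti := vhatOf_denom_antitone hK hμ hw hmono
    refine ⟨hwlow, hone, fun y => ?_⟩
    have hmul := mul_le_mul_of_nonneg_left (hanti y) (hw y).le
    rcases le_total (v y) (vhatOf K ν (uOf K μ v) y) with h | h
    · have hwy : w y = v y := by rw [hstep, min_eq_left h]
      exact (hor y).imp (fun h1 => hwy.trans h1) fun h1 => (h1.trans_eq (by rw [hwy])).trans hmul
    · have hwy : w y = ν y / ∑ x, K x y * uOf K μ v x := by rw [hstep, min_eq_right h, hT]
      refine Or.inr (le_trans (le_of_eq ?_) hmul)
      rw [hwy, div_mul_cancel₀ _ (hS y).ne']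

lemma tendsto_uOf [Fintype Y] [Nonempty Y] (hK : ∀ x y, 0 < K x y) {v : ℕ → Y → ℝ} {w : Y → ℝ}
    (hw : ∀ y, 0 < w y) (h : ∀ y, Tendsto (fun n => v n y) atTop (𝓝 (w y))) (x : X) :
    Tendsto (fun n => uOf K μ (v n) x) atTop (𝓝 (uOf K μ w x)) :=
  tendsto_const_nhds.div (tendsto_finsetSum _ fun y _ => (h y).const_mul _)
    (uOf_denom_pos hK hw x).ne'

lemma tendsto_vhatOf [Fintype X] [Nonempty X] (hK : ∀ x y, 0 < K x y) {u : ℕ → X → ℝ} {w : X → ℝ}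
    (hw : ∀ x, 0 < w x) (h : ∀ x, Tendsto (fun n => u n x) atTop (𝓝 (w x))) (y : Y) :
    Tendsto (fun n => vhatOf K ν (u n) y) atTop (𝓝 (vhatOf K ν w y)) :=
  tendsto_const_nhds.div (tendsto_finsetSum _ fun x _ => (h x).const_mul _)
    (vhatOf_denom_pos hK hw y).ne'

end Sinkhorn

theorem async_sinkhorn_convergence
    {X Y : Type*} [Fintype X] [Fintype Y] [Nonempty X] [Nonempty Y]
    (μ : X → ℝ) (ν : Y → ℝ) (hμ : ∀ x, 0 < μ x) (hν : ∀ y, 0 < ν y)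
    (hμ1 : ∑ x, μ x = 1) (hν1 : ∑ y, ν y = 1)
    (C : ℝ) (hC : 0 ≤ C) (c : X → Y → ℝ) (hc : ∀ x y, 0 ≤ c x y ∧ c x y ≤ C)
    (ε : ℝ) (hε : 0 < ε)
    (K : X → Y → ℝ) (hK : ∀ x y, K x y = Real.exp (-(c x y) / ε) * μ x * ν y)
    (v0 : Y → ℝ) (hv0 : ∀ y, v0 y = 1)
    (v : ℕ → Y → ℝ) (hv : ∀ ℓ, v ℓ = sinkV K μ ν v0 ℓ)
    (u : ℕ → X → ℝ) (hu : ∀ ℓ, u ℓ = uOf K μ (v (ℓ - 1)))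
    (vhat : ℕ → Y → ℝ) (hvhat : ∀ ℓ, vhat ℓ = vhatOf K ν (u ℓ))
    (π : ℕ → X → Y → ℝ) (hπ : ∀ ℓ x y, π ℓ x y = u ℓ x * K x y * v ℓ y)
    (q : ℕ → ℝ) (hq : ∀ ℓ, q ℓ = ∑ x, ∑ y, π ℓ x y)
    (α : ℕ → X → ℝ) (hα : ∀ ℓ x, α ℓ x = ε * Real.log (u ℓ x)) :
    ∃ vinf : Y → ℝ,
      (∀ y, Real.exp (-C / ε) ≤ vinf y) ∧
      (∀ y, Filter.Tendsto (fun ℓ => v ℓ y) Filter.atTop (nhds (vinf y))) ∧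
      (∀ x, Filter.Tendsto (fun ℓ => u ℓ x) Filter.atTop (nhds (uOf K μ vinf x))) ∧
      (∀ x, uOf K μ vinf x * ∑ y, K x y * vinf y = μ x) ∧
      (∀ y, vinf y * ∑ x, K x y * uOf K μ vinf x = ν y) ∧
      Filter.Tendsto q Filter.atTop (nhds 1) := by
  obtain rfl : v = sinkV K μ ν v0 := funext hv
  have hKpos : ∀ x y, 0 < K x y := fun x y => by
    rw [hK]; exact mul_pos (mul_pos (Real.exp_pos _) (hμ x)) (hν y)
  have ha₀ : 0 < Real.exp (-C / ε) := Real.exp_pos _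
  have ha₁ : Real.exp (-C / ε) ≤ 1 :=
    Real.exp_le_one_iff.2 (div_nonpos_of_nonpos_of_nonneg (neg_nonpos.2 hC) hε.le)
  have ha : ∀ x y z, Real.exp (-C / ε) * K x y * ν z ≤ K x z * ν y := fun x y z => by
    have h1 : Real.exp (-(c x y) / ε) ≤ 1 :=
      Real.exp_le_one_iff.2 (div_nonpos_of_nonpos_of_nonneg (neg_nonpos.2 (hc x y).1) hε.le)
    have h2 : Real.exp (-C / ε) ≤ Real.exp (-(c x z) / ε) :=
      Real.exp_le_exp.2 (div_le_div_of_nonneg_right (neg_le_neg (hc x z).2) hε.le)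
    have h3 : Real.exp (-C / ε) * Real.exp (-(c x y) / ε) ≤ Real.exp (-(c x z) / ε) :=
      (mul_le_of_le_one_right ha₀.le h1).trans h2
    have h4 : 0 ≤ μ x * ν y * ν z := (mul_pos (mul_pos (hμ x) (hν y)) (hν z)).le
    rw [hK, hK]
    linarith [mul_le_mul_of_nonneg_right h3 h4]
  have hmass : ∑ x, μ x = ∑ y, ν y := hμ1.trans hν1.symm
  have hlow := fun n => (sinkV_invariant hKpos hμ hmass ha₀ ha₁ ha hv0 n).1
  have hlim : ∀ y, ∃ l, Tendsto (fun n => sinkV K μ ν v0 n y) atTop (𝓝 l) := fun y =>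
    ⟨_, tendsto_atTop_ciInf (antitone_nat_of_succ_le fun n => sinkV_succ_le v0 n y)
      ⟨Real.exp (-C / ε), by rintro _ ⟨n, rfl⟩; exact hlow n y⟩⟩
  choose w hw using hlim
  have hwlow : ∀ y, Real.exp (-C / ε) ≤ w y := fun y =>
    ge_of_tendsto' (hw y) fun n => hlow n y
  have hwpos : ∀ y, 0 < w y := fun y => ha₀.trans_le (hwlow y)
  have huw := tendsto_uOf (μ := μ) hKpos hwpos hw
  have hle : ∀ y, w y ≤ vhatOf K ν (uOf K μ w) y := fun y =>
    le_of_tendsto_of_tendsto' ((tendsto_add_atTop_iff_nat 1).2 (hw y))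
      (tendsto_vhatOf hKpos (uOf_pos hKpos hμ hwpos) huw y) fun n => min_le_right _ _
  have hu_lim : ∀ x, Tendsto (fun ℓ => u ℓ x) atTop (𝓝 (uOf K μ w x)) := fun x => by
    simp_rw [hu]
    exact (huw x).comp (tendsto_sub_atTop_nat 1)
  refine ⟨w, hwlow, hw, hu_lim, uOf_mul_denom hKpos hwpos,
    mul_vhatOf_denom_eq_of_le hKpos hμ hmass hwpos hle, ?_⟩
  have hone : ∑ x, ∑ y, uOf K μ w x * K x y * w y = 1 := by
    simp_rw [mul_assoc, ← Finset.mul_sum, uOf_mul_denom hKpos hwpos]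
    exact hμ1
  simp_rw [funext hq, hπ, ← hone]
  exact tendsto_finsetSum _ fun x _ => tendsto_finsetSum _ fun y _ =>
    ((hu_lim x).mul_const _).mul (hw y)
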